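/- For every integer m ≥ r + 1 one has \overline{t^{−m} u\, dt} = (1/((2m − 3) a₁)) Σ_{j=2}^{r+1} (3j − 2m) a_j \overline{t^{−m+j−1} u\, dt} in Ω_R/dR. -/

import Mathlib

open scoped BigOperators

noncomputable section

/-- The hyperelliptic ring `R = ℂ[t,t⁻¹,u : u² = p(t)]`, realized as
`ℂ[t,t⁻¹][X]/(X² - p)`. -/
abbrev HypRing (p : LaurentPolynomial ℂ) : Type :=
  AdjoinRoot (Polynomial.X ^ 2 - Polynomial.C p)

/-- The element `t^i` of `R`, for `i : ℤ`. -/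
noncomputable def tP (p : LaurentPolynomial ℂ) (i : ℤ) : HypRing p :=
  AdjoinRoot.of _ (LaurentPolynomial.T i)

/-- The element `u` of `R`. -/
noncomputable def uE (p : LaurentPolynomial ℂ) : HypRing p := AdjoinRoot.root _

/-- The module of Kähler differentials `Ω_R` of `R` over `ℂ`. -/
abbrev HypOmega (p : LaurentPolynomial ℂ) := KaehlerDifferential ℂ (HypRing p)

/-- The subspace `dR ⊆ Ω_R` of exact differentials. -/
noncomputable def dSub (p : LaurentPolynomial ℂ) : Submodule ℂ (HypOmega p) :=
  LinearMap.range (KaehlerDifferential.D ℂ (HypRing p)).toLinearMap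

/-- The quotient `Ω_R/dR`. -/
abbrev HypCenter (p : LaurentPolynomial ℂ) := HypOmega p ⧸ dSub p

/-- The class `\overline{f dg}` of `f dg` in `Ω_R/dR`. -/
noncomputable def cls (p : LaurentPolynomial ℂ) (f g : HypRing p) : HypCenter p :=
  Submodule.Quotient.mk (f • (KaehlerDifferential.D ℂ (HypRing p) g))

/-- `ω₀ = \overline{t⁻¹ dt}` and `ω_k = \overline{t^{-k} u dt}` for `k ≥ 1`. -/
noncomputable def om (p : LaurentPolynomial ℂ) (k : ℕ) : HypCenter p :=
  if k = 0 then cls p (tP p (-1)) (tP p 1)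
  else cls p (tP p (-(k : ℤ)) * uE p) (tP p 1)
theorem tP_add (p : LaurentPolynomial ℂ) (i j : ℤ) : tP p (i + j) = tP p i * tP p j := by
  rw [tP, LaurentPolynomial.T_add, map_mul, tP, tP]

theorem tP_zero (p : LaurentPolynomial ℂ) : tP p 0 = 1 := by
  simp [tP]

/-- `d(tᵏ) = k tᵏ⁻¹ dt` for every integer `k`. -/
theorem D_tP (p : LaurentPolynomial ℂ) (k : ℤ) :
    KaehlerDifferential.D ℂ (HypRing p) (tP p k) =
      (k : ℂ) • tP p (k - 1) • KaehlerDifferential.D ℂ (HypRing p) (tP p 1) := by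
  have step (k : ℤ) : KaehlerDifferential.D ℂ (HypRing p) (tP p (k + 1)) =
      tP p k • KaehlerDifferential.D ℂ (HypRing p) (tP p 1) +
        tP p 1 • KaehlerDifferential.D ℂ (HypRing p) (tP p k) := by
    rw [tP_add, Derivation.leibniz]
  have shift (c : ℂ) (i j : ℤ) (x : HypOmega p) :
      tP p i • c • tP p j • x = c • tP p (i + j) • x := by
    rw [smul_comm, smul_smul (tP p i), tP_add]
  induction k using Int.induction_on with
  | zero => simp [tP_zero]
  | succ n ih =>
    rw [step, ih, shift, add_sub_cancel, add_sub_cancel_right, Int.cast_add, add_smul, Int.cast_one,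
      one_smul, add_comm]
  | pred n ih =>
    have h := step (-n - 1)
    rw [sub_add_cancel, ih] at h
    have h' := congrArg (tP p (-1) • ·) (eq_sub_of_add_eq' h.symm)
    simp only [smul_sub, smul_smul (tP p (-1)) (tP p 1), ← tP_add, shift, neg_add_cancel, tP_zero,
      one_smul, smul_smul (tP p (-1)) (tP p (-n - 1))] at h'
    rw [h', show (-1 + (-(n : ℤ) - 1)) = -n - 1 - 1 by ring, Int.cast_sub, sub_smul, Int.cast_one,
      one_smul]

theorem uE_sq (p : LaurentPolynomial ℂ) : uE p ^ 2 = AdjoinRoot.of _ p := by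
  have h := AdjoinRoot.eval₂_root (Polynomial.X ^ 2 - Polynomial.C p)
  rw [Polynomial.eval₂_sub, Polynomial.eval₂_pow, Polynomial.eval₂_X, Polynomial.eval₂_C] at h
  exact sub_eq_zero.mp h

theorem of_C_mul_T (p : LaurentPolynomial ℂ) (c : ℂ) (i : ℤ) :
    (AdjoinRoot.of _ (LaurentPolynomial.C c * LaurentPolynomial.T i) : HypRing p) =
      c • tP p i := by
  rw [← LaurentPolynomial.smul_eq_C_mul]
  exact (AdjoinRoot.smul_of _ _ _).symm

/-- Twice the exact differential `d(tᵏ u³)`, expressed through the forms `tⁱ u dt`. -/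
theorem two_smul_D_tP_mul_uE_pow_three (p : LaurentPolynomial ℂ) (s : Finset ℕ) (a : ℕ → ℂ)
    (hpa : p = ∑ i ∈ s, LaurentPolynomial.C (a i) * LaurentPolynomial.T (i : ℤ)) (k : ℤ) :
    (2 : ℂ) • KaehlerDifferential.D ℂ (HypRing p) (tP p k * uE p ^ 3) =
      ∑ j ∈ s, (((3 * (j : ℤ) + 2 * k : ℤ) : ℂ) * a j) •
        (tP p (k + j - 1) * uE p) • KaehlerDifferential.D ℂ (HypRing p) (tP p 1) := by
  set D := KaehlerDifferential.D ℂ (HypRing p)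
  have hsq : uE p ^ 2 = ∑ j ∈ s, a j • tP p j := by
    rw [uE_sq]
    refine (congrArg (AdjoinRoot.of _) hpa).trans ?_
    simp only [map_sum, of_C_mul_T]
  have hD : D (uE p ^ 2) = ∑ j ∈ s, a j • (j : ℂ) • tP p (j - 1) • D (tP p 1) := by
    rw [hsq, map_sum]
    refine Finset.sum_congr rfl fun j _ => ?_
    rw [Derivation.map_smul, D_tP, Int.cast_natCast]
  have hcube : (2 : ℂ) • D (uE p ^ 3) = (3 : ℂ) • uE p • D (uE p ^ 2) := by
    rw [Derivation.leibniz_pow, Derivation.leibniz_pow]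
    simp only [← Nat.cast_smul_eq_nsmul ℂ, smul_comm (uE p) _ _, smul_smul]
    norm_num
    ring_nf
  have hk : (2 : ℂ) • D (tP p k * uE p ^ 3) = tP p k • ((3 : ℂ) • uE p • D (uE p ^ 2)) +
      (2 : ℂ) • (uE p * uE p ^ 2) • D (tP p k) := by
    rw [Derivation.leibniz, smul_add, ← hcube, smul_comm (tP p k), ← pow_succ']
  rw [hk, hD, hsq, show D (tP p k) = _ from D_tP p k, Finset.mul_sum, Finset.sum_smul]
  simp only [Finset.smul_sum]
  rw [← Finset.sum_add_distrib]
  refine Finset.sum_congr rfl fun j _ => ?_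
  have e₁ : tP p k * (uE p * tP p (j - 1)) = tP p (k + j - 1) * uE p := by
    rw [add_sub_assoc, tP_add]; ring
  have e₂ : uE p * tP p j * tP p (k - 1) = tP p (k + j - 1) * uE p := by
    rw [show k + j - 1 = j + (k - 1) by ring, tP_add]; ring
  rw [mul_smul_comm, smul_assoc (a j), smul_comm (uE p * tP p j) (k : ℂ), smul_smul _ (tP p (k - 1)),
    e₂, smul_comm (uE p) (a j), smul_comm (uE p) (j : ℂ), smul_comm (tP p k) (3 : ℂ),
    smul_comm (tP p k) (a j), smul_comm (tP p k) (j : ℂ), smul_smul (uE p), smul_smul (tP p k), e₁]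
  push_cast
  module

theorem sum_smul_cls_eq_zero (p : LaurentPolynomial ℂ) (s : Finset ℕ) (a : ℕ → ℂ)
    (hpa : p = ∑ i ∈ s, LaurentPolynomial.C (a i) * LaurentPolynomial.T (i : ℤ)) (k : ℤ) :
    ∑ j ∈ s, (((3 * (j : ℤ) + 2 * k : ℤ) : ℂ) * a j) •
      cls p (tP p (k + j - 1) * uE p) (tP p 1) = 0 := by
  have h := congrArg (dSub p).mkQ (two_smul_D_tP_mul_uE_pow_three p s a hpa k)
  have hexact : (dSub p).mkQ (KaehlerDifferential.D ℂ (HypRing p) (tP p k * uE p ^ 3)) = 0 :=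
    (Submodule.Quotient.mk_eq_zero (dSub p)).mpr ⟨_, rfl⟩
  rw [map_smul, map_sum, hexact, smul_zero] at h
  simp only [map_smul] at h
  exact h.symm

theorem linear_coeff_ne_zero (r : ℕ) (α : Fin r → ℂ) (hα0 : ∀ i, α i ≠ 0) (a : ℕ → ℂ)
    (h : LaurentPolynomial.T 1 *
        ∏ i : Fin r, (LaurentPolynomial.T 1 - LaurentPolynomial.C (α i)) =
      ∑ i ∈ Finset.Icc 1 (r + 1), LaurentPolynomial.C (a i) * LaurentPolynomial.T (i : ℤ)) :
    a 1 ≠ 0 := by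
  have hpoly : (Polynomial.X * ∏ i : Fin r, (Polynomial.X - Polynomial.C (α i))) =
      ∑ i ∈ Finset.Icc 1 (r + 1), Polynomial.C (a i) * Polynomial.X ^ i := by
    apply Polynomial.toLaurent_injective
    simpa [Polynomial.toLaurent_X] using h
  have hcoeff := congrArg (Polynomial.coeff · 1) hpoly
  simp only [Polynomial.finsetSum_coeff, Polynomial.coeff_C_mul_X_pow, Polynomial.coeff_X_mul,
    Polynomial.coeff_zero_eq_eval_zero, Polynomial.eval_prod] at hcoeff
  simp at hcoeff
  rw [← hcoeff]
  simp [Finset.prod_ne_zero_iff, hα0]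

/-- For every integer `m ≥ r + 1` one has
`\overline{t^{−m} u dt} = (1/((2m−3)a₁)) Σ_{j=2}^{r+1} (3j−2m) a_j \overline{t^{−m+j−1} u dt}`
in `Ω_R/dR`. -/
theorem tnegpow_u_dt_recursion (r : ℕ) (hr : 1 ≤ r)
    (α : Fin r → ℂ) (hα0 : ∀ i, α i ≠ 0) (hαinj : Function.Injective α)
    (a : ℕ → ℂ) (p : LaurentPolynomial ℂ)
    (hp : p = LaurentPolynomial.T 1 *
      ∏ i : Fin r, (LaurentPolynomial.T 1 - LaurentPolynomial.C (α i)))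
    (hpa : p = ∑ i ∈ Finset.Icc 1 (r + 1),
      LaurentPolynomial.C (a i) * LaurentPolynomial.T (i : ℤ)) :
    ∀ m : ℤ, (r : ℤ) + 1 ≤ m →
      cls p (tP p (-m) * uE p) (tP p 1)
        = ∑ j ∈ Finset.Icc 2 (r + 1),
            ((1 / (((2 * m - 3 : ℤ) : ℂ) * a 1)) * ((3 * (j : ℤ) - 2 * m : ℤ) : ℂ) * a j) •
              cls p (tP p (-m + j - 1) * uE p) (tP p 1) := by
  intro m _
  have ha : a 1 ≠ 0 := linear_coeff_ne_zero r α hα0 a (hp.symm.trans hpa)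
  have hm : ((2 * m - 3 : ℤ) : ℂ) ≠ 0 := by
    rw [Int.cast_ne_zero]
    omega
  have h := sum_smul_cls_eq_zero p _ a hpa (-m)
  rw [← Finset.insert_Icc_add_one_left_eq_Icc (by omega : 1 ≤ r + 1),
    Finset.sum_insert (by simp), add_eq_zero_iff_eq_neg, Nat.cast_one, add_sub_cancel_right] at h
  have hc : (((3 * 1 + 2 * -m : ℤ) : ℂ) * a 1) = -(((2 * m - 3 : ℤ) : ℂ) * a 1) := by
    push_cast
    ring
  rw [hc, neg_smul, neg_inj] at h
  rw [← inv_smul_smul₀ (mul_ne_zero hm ha) (cls p (tP p (-m) * uE p) (tP p 1)), h,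
    Finset.smul_sum]
  refine Finset.sum_congr rfl fun j _ => ?_
  rw [smul_smul, one_div, mul_assoc, mul_neg, ← sub_eq_add_neg]

end
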